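/- arXiv:1206.3047 — 8 statements merged into one kernel-verified Lean document; each statement's English description precedes it below -/
import Mathlib

section
/- Let β > 0 and let Φ, Ψ : ℝ^d → ℂ be continuous functions such that for every y ∈ ℝ^d the function w ↦ Ψ(w • y)/w is Lebesgue integrable on the interval (0,1]. If Φ(y) = ∫_{(0,1]} Ψ(w • y) w⁻¹ dw + β⁻¹ Ψ(y) for every y ∈ ℝ^d, then β ∫_{(0,1]} Φ(t • y) t^{β−1} dt = ∫_{(0,1]} Ψ(t • y) t⁻¹ dt for every y ∈ ℝ^d. -/
open MeasureTheory Set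

/-- Rescaling the argument of a Lévy exponent truncates its logarithmic integral. -/
theorem setIntegral_smul_smul_div {E : Type*} [AddCommGroup E] [Module ℝ E]
    (Ψ : E → ℂ) (y : E) {t : ℝ} (ht : t ≠ 0) :
    ∫ w in Ioc (0 : ℝ) 1, Ψ (w • t • y) / (w : ℂ)
      = ∫ w in (0 : ℝ)..t, Ψ (w • y) / (w : ℂ) := by
  have htC : (t : ℂ) ≠ 0 := by exact_mod_cast ht
  have hsub := intervalIntegral.smul_integral_comp_mul_right (a := 0) (b := 1)
    (fun w : ℝ => Ψ (w • y) / (w : ℂ)) t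
  rw [zero_mul, one_mul] at hsub
  rw [← hsub, ← intervalIntegral.integral_of_le zero_le_one, ← intervalIntegral.integral_smul]
  refine intervalIntegral.integral_congr fun w _ => ?_
  simp only [smul_smul, Complex.real_smul, Complex.ofReal_mul]
  rw [mul_div_assoc', mul_comm (w : ℂ), mul_div_mul_left _ _ htC]

/-- Proposition 2, (ii) ⇒ (i) at the level of Lévy exponents. -/
theorem prop2_ii_implies_i (d : ℕ) (β : ℝ) (hβ : 0 < β)
    (Φ Ψ : EuclideanSpace ℝ (Fin d) → ℂ)
    (hΦ : Continuous Φ) (hΨ : Continuous Ψ)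
    (hint : ∀ y : EuclideanSpace ℝ (Fin d),
      IntegrableOn (fun w : ℝ => Ψ (w • y) / (w : ℂ)) (Ioc 0 1))
    (h : ∀ y : EuclideanSpace ℝ (Fin d),
      Φ y = (∫ w in Ioc (0:ℝ) 1, Ψ (w • y) / (w : ℂ)) + (β : ℂ)⁻¹ * Ψ y) :
    ∀ y : EuclideanSpace ℝ (Fin d),
      (β : ℂ) * ∫ t in Ioc (0:ℝ) 1, Φ (t • y) * ((t ^ (β - 1) : ℝ) : ℂ)
        = ∫ t in Ioc (0:ℝ) 1, Ψ (t • y) / (t : ℂ) := by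
  intro y
  set g : ℝ → ℂ := fun w => Ψ (w • y) / (w : ℂ) with hg
  have hgI : IntervalIntegrable g volume 0 1 :=
    (intervalIntegrable_iff_integrableOn_Ioc_of_le zero_le_one).2 (hint y)
  have hΦF : ∀ t : ℝ, t ≠ 0 →
      Φ (t • y) = (∫ w in (0 : ℝ)..t, g w) + (β : ℂ)⁻¹ * Ψ (t • y) := by
    intro t ht
    rw [h, setIntegral_smul_smul_div Ψ y ht]
  have hβ' : (β : ℂ) ≠ 0 := by exact_mod_cast hβ.ne'
  have hderiv : ∀ t ∈ Ioo (0 : ℝ) 1,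
      HasDerivAt (fun t : ℝ => ((t ^ β : ℝ) : ℂ) * ∫ w in (0 : ℝ)..t, g w)
        ((β : ℂ) * (Φ (t • y) * ((t ^ (β - 1) : ℝ) : ℂ))) t := by
    intro t ht
    have htC : (t : ℂ) ≠ 0 := by exact_mod_cast ht.1.ne'
    have hgt : ContinuousAt g t :=
      ContinuousAt.div (by fun_prop) Complex.continuous_ofReal.continuousAt htC
    have hgm : Measurable g := by
      have : Measurable fun w : ℝ => Ψ (w • y) := Continuous.measurable (by fun_prop)
      exact this.div Complex.measurable_ofReal
    have hF : HasDerivAt (fun t : ℝ => ∫ w in (0 : ℝ)..t, g w) (g t) t :=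
      intervalIntegral.integral_hasDerivAt_right
        (hgI.mono_set (by
          rw [uIcc_of_le ht.1.le, uIcc_of_le zero_le_one]
          exact Icc_subset_Icc_right ht.2.le))
        hgm.stronglyMeasurable.stronglyMeasurableAtFilter hgt
    have hpow := (Real.hasDerivAt_rpow_const (p := β) (Or.inl ht.1.ne')).ofReal_comp
    refine (hpow.mul hF).congr_deriv ?_
    have hsplit : t ^ β = t ^ (β - 1) * t := by
      rw [← Real.rpow_add_one ht.1.ne', sub_add_cancel]
    rw [hΦF t ht.1.ne', hsplit]
    simp only [hg]
    push_cast
    field_simp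
  have hcont : ContinuousOn (fun t : ℝ => ((t ^ β : ℝ) : ℂ) * ∫ w in (0 : ℝ)..t, g w)
      (Icc 0 1) := by
    refine ContinuousOn.mul ?_ ?_
    · exact (Complex.continuous_ofReal.comp
        (Real.continuous_rpow_const hβ.le)).continuousOn
    · have := intervalIntegral.continuousOn_primitive_interval' hgI left_mem_uIcc
      rwa [uIcc_of_le zero_le_one] at this
  have hintegrable : IntervalIntegrable
      (fun t : ℝ => (β : ℂ) * (Φ (t • y) * ((t ^ (β - 1) : ℝ) : ℂ))) volume 0 1 := by
    have hpow : IntervalIntegrable (fun t : ℝ => t ^ (β - 1)) volume 0 1 :=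
      intervalIntegral.intervalIntegrable_rpow' (by linarith)
    have hpowC : IntervalIntegrable (fun t : ℝ => ((t ^ (β - 1) : ℝ) : ℂ)) volume 0 1 :=
      ⟨hpow.1.ofReal, hpow.2.ofReal⟩
    exact (hpowC.continuousOn_mul (Continuous.continuousOn (by fun_prop))).const_mul _
  have hFTC := intervalIntegral.integral_eq_sub_of_hasDerivAt_of_le zero_le_one
    hcont hderiv hintegrable
  rw [intervalIntegral.integral_const_mul] at hFTC
  simpa [intervalIntegral.integral_of_le, hg] using hFTC
end

section
/- Let β > 0 and let Φ, Ψ : ℝ^d → ℂ be continuous functions such that for every y ∈ ℝ^d the function w ↦ Ψ(w • y)/w is Lebesgue integrable on the interval (0,1]. If β ∫_{(0,1]} Φ(t • y) t^{β−1} dt = ∫_{(0,1]} Ψ(t • y) t⁻¹ dt for every y ∈ ℝ^d, then Φ(y) = ∫_{(0,1]} Ψ(w • y) w⁻¹ dw + β⁻¹ Ψ(y) for every y ∈ ℝ^d. -/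
open MeasureTheory Set

open intervalIntegral in
/-- Rescaling to the interval `[0, s]` and differentiating at `s = 1`. -/
theorem eq_integral_add_of_forall_mul_integral_rpow_eq {β : ℝ} (hβ : 0 < β) {f g : ℝ → ℂ}
    (hf : Continuous f) (hg : Continuous g)
    (hint : IntervalIntegrable (fun w : ℝ => g w / (w : ℂ)) volume 0 1)
    (h : ∀ s : ℝ, 0 < s →
      (β : ℂ) * ∫ t in (0 : ℝ)..1, f (s * t) * ((t ^ (β - 1) : ℝ) : ℂ)
        = ∫ t in (0 : ℝ)..1, g (s * t) / (t : ℂ)) :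
    f 1 = (∫ w in (0 : ℝ)..1, g w / (w : ℂ)) + (β : ℂ)⁻¹ * g 1 := by
  set k : ℝ → ℂ := fun u => f u * ((u ^ (β - 1) : ℝ) : ℂ) with hk
  set j : ℝ → ℂ := fun u => g u / (u : ℂ) with hj
  have hrpow : IntervalIntegrable (fun u : ℝ => u ^ (β - 1)) volume 0 1 :=
    intervalIntegrable_rpow' (by linarith)
  have hkint : IntervalIntegrable k volume 0 1 :=
    IntervalIntegrable.continuousOn_mul ⟨hrpow.1.ofReal, hrpow.2.ofReal⟩ hf.continuousOn
  have hkcont : ContinuousOn k (Ioi 0) :=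
    hf.continuousOn.mul (Complex.continuous_ofReal.comp_continuousOn
      (continuousOn_id.rpow_const fun x hx => Or.inl (ne_of_gt hx)))
  have hjcont : ContinuousOn j (Ioi 0) :=
    hg.continuousOn.div Complex.continuous_ofReal.continuousOn
      fun x hx => Complex.ofReal_ne_zero.mpr (ne_of_gt hx)
  have deriv_primitive {q : ℝ → ℂ} (hq : IntervalIntegrable q volume 0 1)
      (hqc : ContinuousOn q (Ioi 0)) : HasDerivAt (fun s : ℝ => ∫ u in (0 : ℝ)..s, q u) (q 1) 1 :=
    integral_hasDerivAt_right hq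
      (hqc.stronglyMeasurableAtFilter isOpen_Ioi 1 (mem_Ioi.mpr one_pos))
      (hqc.continuousAt (Ioi_mem_nhds one_pos))
  have hscale : ∀ s : ℝ, 0 < s →
      (β : ℂ) * ∫ u in (0 : ℝ)..s, k u = ((s ^ β : ℝ) : ℂ) * ∫ u in (0 : ℝ)..s, j u := by
    intro s hs
    have hs' : (s : ℂ) ≠ 0 := Complex.ofReal_ne_zero.mpr hs.ne'
    have hleft : ∫ u in (0 : ℝ)..s, k u
        = ((s ^ β : ℝ) : ℂ) * ∫ t in (0 : ℝ)..1, f (s * t) * ((t ^ (β - 1) : ℝ) : ℂ) := by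
      have hsub := smul_integral_comp_mul_left (a := 0) (b := 1) k s
      rw [mul_zero, mul_one] at hsub
      rw [← hsub, ← intervalIntegral.integral_smul, ← intervalIntegral.integral_const_mul]
      refine integral_congr fun t ht => ?_
      rw [uIcc_of_le zero_le_one] at ht
      have hpow : s ^ β = s * s ^ (β - 1) := by
        rw [Real.rpow_sub_one hs.ne']
        field_simp
      simp only [hk, Complex.real_smul, Real.mul_rpow hs.le ht.1, hpow]
      push_cast
      ring
    have hright : ∫ u in (0 : ℝ)..s, j u = ∫ t in (0 : ℝ)..1, g (s * t) / (t : ℂ) := by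
      have hsub := smul_integral_comp_mul_left (a := 0) (b := 1) j s
      rw [mul_zero, mul_one] at hsub
      rw [← hsub, ← intervalIntegral.integral_smul]
      refine integral_congr fun t _ => ?_
      simp only [hj, Complex.real_smul, Complex.ofReal_mul]
      rw [← mul_div_assoc, mul_div_mul_left _ _ hs']
    rw [hleft, hright, ← h s hs]
    ring
  have hderivl := (deriv_primitive hkint hkcont).const_mul (β : ℂ)
  have hderivr := (Real.hasDerivAt_rpow_const (x := 1) (p := β) (Or.inl one_ne_zero)).ofReal_comp.mul
    (deriv_primitive hint hjcont)
  have heq := hderivl.unique (hderivr.congr_of_eventuallyEq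
    (Filter.eventually_of_mem (Ioi_mem_nhds one_pos) hscale))
  have hβ' : (β : ℂ) ≠ 0 := Complex.ofReal_ne_zero.mpr hβ.ne'
  simp only [hk, hj, Real.one_rpow, Complex.ofReal_one, mul_one, one_mul, div_one] at heq
  apply mul_left_cancel₀ hβ'
  rw [heq, mul_add, mul_inv_cancel_left₀ hβ']

/-- Proposition 2, (i) ⇒ (ii) at the level of Lévy exponents. -/
theorem prop2_i_implies_ii (d : ℕ) (β : ℝ) (hβ : 0 < β)
    (Φ Ψ : EuclideanSpace ℝ (Fin d) → ℂ)
    (hΦ : Continuous Φ) (hΨ : Continuous Ψ)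
    (hint : ∀ y : EuclideanSpace ℝ (Fin d),
      IntegrableOn (fun w : ℝ => Ψ (w • y) / (w : ℂ)) (Ioc 0 1))
    (h : ∀ y : EuclideanSpace ℝ (Fin d),
      (β : ℂ) * ∫ t in Ioc (0:ℝ) 1, Φ (t • y) * ((t ^ (β - 1) : ℝ) : ℂ)
        = ∫ t in Ioc (0:ℝ) 1, Ψ (t • y) / (t : ℂ)) :
    ∀ y : EuclideanSpace ℝ (Fin d),
      Φ y = (∫ w in Ioc (0:ℝ) 1, Ψ (w • y) / (w : ℂ)) + (β : ℂ)⁻¹ * Ψ y := by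
  intro y
  simp only [← intervalIntegral.integral_of_le (zero_le_one' ℝ)] at h ⊢
  have hmain := eq_integral_add_of_forall_mul_integral_rpow_eq hβ
    (f := fun t : ℝ => Φ (t • y)) (g := fun t : ℝ => Ψ (t • y)) (by fun_prop) (by fun_prop)
    ((intervalIntegrable_iff_integrableOn_Ioc_of_le zero_le_one).mpr (hint y))
    (fun s _ => by simpa only [smul_smul, mul_comm] using h (s • y))
  simpa only [one_smul] using hmain
end

section
/- Let β > 0, let N be an s-finite Borel measure on ℝ^d, and let A ⊆ ℝ^d be a Borel set. Then ∫_{(0,1]} ( ∫_{(0,1]} N({x : (t^{1/β} s) • x ∈ A}) dt ) s⁻¹ ds = ∫_{(0,1]} N({x : w • x ∈ A}) (w⁻¹ − w^{β−1}) dw, where all integrals are Lebesgue integrals with values in [0,∞] (note that w⁻¹ − w^{β−1} ≥ 0 for w ∈ (0,1]). -/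
open MeasureTheory Set

theorem image_div_rpow_Ioc {β s : ℝ} (hβ : 0 < β) (hs : 0 < s) :
    (fun w : ℝ => (w / s) ^ β) '' Ioc 0 s = Ioc 0 1 := by
  ext t
  constructor
  · rintro ⟨w, ⟨hw0, hws⟩, rfl⟩
    exact ⟨Real.rpow_pos_of_pos (div_pos hw0 hs) β,
      Real.rpow_le_one (div_pos hw0 hs).le ((div_le_one hs).2 hws) hβ.le⟩
  · rintro ⟨ht0, ht1⟩
    refine ⟨t ^ (1 / β) * s, ⟨mul_pos (Real.rpow_pos_of_pos ht0 _) hs, ?_⟩, ?_⟩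
    · exact mul_le_of_le_one_left hs.le (Real.rpow_le_one ht0.le ht1 (by positivity))
    · simp only
      rw [mul_div_cancel_right₀ _ hs.ne', ← Real.rpow_mul ht0.le, one_div_mul_cancel hβ.ne',
        Real.rpow_one]

theorem setLIntegral_comp_rpow_mul (g : ℝ → ENNReal) {β s : ℝ} (hβ : 0 < β) (hs : 0 < s) :
    ∫⁻ t in Ioc (0 : ℝ) 1, g (t ^ (1 / β) * s)
      = ∫⁻ w in Ioc 0 s, ENNReal.ofReal (β * w ^ (β - 1) * s ^ (-β)) * g w := by
  rw [← image_div_rpow_Ioc hβ hs,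
    lintegral_image_eq_lintegral_abs_deriv_mul (f' := fun w => β * w ^ (β - 1) * s ^ (-β))
      measurableSet_Ioc]
  · refine setLIntegral_congr_fun measurableSet_Ioc fun w hw => ?_
    have hw0 : 0 < w := hw.1
    have hnonneg : 0 ≤ β * w ^ (β - 1) * s ^ (-β) := by positivity
    rw [abs_of_nonneg hnonneg, ← Real.rpow_mul (div_pos hw0 hs).le, mul_one_div_cancel hβ.ne',
      Real.rpow_one, div_mul_cancel₀ _ hs.ne']
  · intro w hw
    have hderiv := ((hasDerivAt_id w).div_const s).rpow_const (p := β)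
      (Or.inl (div_pos hw.1 hs).ne')
    refine (hderiv.congr_deriv ?_).hasDerivWithinAt
    simp only [id]
    rw [Real.div_rpow hw.1.le hs.le, Real.rpow_neg hs.le, Real.rpow_sub_one hs.ne']
    have := (Real.rpow_pos_of_pos hs β).ne'
    field_simp
  · intro x hx y hy hxy
    have := (Real.rpow_left_inj (div_pos hx.1 hs).le (div_pos hy.1 hs).le hβ.ne').1 hxy
    exact (div_left_inj' hs.ne').1 this

theorem setLIntegral_Icc_rpow_kernel {β w : ℝ} (hβ : 0 < β) (hw : w ∈ Ioc (0 : ℝ) 1) :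
    ∫⁻ s in Icc w 1, ENNReal.ofReal (β * w ^ (β - 1) * s ^ (-β - 1))
      = ENNReal.ofReal (w⁻¹ - w ^ (β - 1)) := by
  have hw0 : 0 < w := hw.1
  have hzero : (0 : ℝ) ∉ uIcc w 1 := by
    rw [uIcc_of_le hw.2]
    exact fun h => hw0.not_ge h.1
  have hint : IntegrableOn (fun s : ℝ => β * w ^ (β - 1) * s ^ (-β - 1)) (Ioc w 1) :=
    ((intervalIntegrable_iff_integrableOn_Ioc_of_le hw.2).1
      ((intervalIntegral.intervalIntegrable_rpow (Or.inr hzero)).const_mul _))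
  rw [setLIntegral_congr Ioc_ae_eq_Icc.symm, ← ofReal_integral_eq_lintegral_ofReal hint]
  · rw [← intervalIntegral.integral_of_le hw.2, intervalIntegral.integral_const_mul,
      integral_rpow (Or.inr ⟨by linarith, hzero⟩), sub_add_cancel, Real.one_rpow,
      Real.rpow_neg hw0.le, Real.rpow_sub_one hw0.ne']
    have := (Real.rpow_pos_of_pos hw0 β).ne'
    congr 1
    field_simp
    ring
  · refine (ae_restrict_iff' measurableSet_Ioc).2 (ae_of_all _ fun s hs => ?_)
    have hs0 : 0 < s := hw0.trans hs.1
    simp only [Pi.zero_apply]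
    positivity

theorem setLIntegral_setLIntegral_comp_rpow_mul {g : ℝ → ENNReal} (hg : Measurable g) {β : ℝ}
    (hβ : 0 < β) :
    ∫⁻ s in Ioc (0 : ℝ) 1,
        (∫⁻ t in Ioc (0 : ℝ) 1, g (t ^ (1 / β) * s)) * ENNReal.ofReal s⁻¹
      = ∫⁻ w in Ioc (0 : ℝ) 1, g w * ENNReal.ofReal (w⁻¹ - w ^ (β - 1)) := by
  let F : ℝ → ℝ → ENNReal := fun s w =>
    {p : ℝ × ℝ | p.2 ≤ p.1}.indicator
      (fun p => g p.2 * ENNReal.ofReal (β * p.2 ^ (β - 1) * p.1 ^ (-β - 1))) (s, w)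
  have hF : Measurable (Function.uncurry F) :=
    Measurable.indicator (by fun_prop) (measurableSet_le measurable_snd measurable_fst)
  calc
    _ = ∫⁻ s in Ioc (0 : ℝ) 1, ∫⁻ w in Ioc (0 : ℝ) 1, F s w := by
      refine setLIntegral_congr_fun measurableSet_Ioc fun s hs => ?_
      have hs0 : 0 < s := hs.1
      have hset : Iic s ∩ Ioc 0 1 = Ioc 0 s := by
        ext w
        exact ⟨fun h => ⟨h.2.1, h.1⟩, fun h => ⟨h.2, h.1, h.2.trans hs.2⟩⟩
      change _ = ∫⁻ w in Ioc (0 : ℝ) 1, (Iic s).indicator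
        (fun w => g w * ENNReal.ofReal (β * w ^ (β - 1) * s ^ (-β - 1))) w
      rw [setLIntegral_indicator measurableSet_Iic, hset, setLIntegral_comp_rpow_mul g hβ hs0,
        ← lintegral_mul_const _ (by fun_prop)]
      refine setLIntegral_congr_fun measurableSet_Ioc fun w hw => ?_
      have hw0 : 0 < w := hw.1
      rw [mul_comm _ (g w), mul_assoc, ← ENNReal.ofReal_mul (by positivity),
        Real.rpow_sub_one hs0.ne', mul_assoc _ _ s⁻¹, ← div_eq_mul_inv (s ^ (-β))]
    _ = ∫⁻ w in Ioc (0 : ℝ) 1, ∫⁻ s in Ioc (0 : ℝ) 1, F s w :=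
      lintegral_lintegral_swap hF.aemeasurable
    _ = _ := by
      refine setLIntegral_congr_fun measurableSet_Ioc fun w hw => ?_
      have hset : Ici w ∩ Ioc 0 1 = Icc w 1 := by
        ext s
        exact ⟨fun h => ⟨h.1, h.2.2⟩, fun h => ⟨h.1, hw.1.trans_le h.1, h.2⟩⟩
      change ∫⁻ s in Ioc (0 : ℝ) 1, (Ici w).indicator
        (fun s => g w * ENNReal.ofReal (β * w ^ (β - 1) * s ^ (-β - 1))) s = _
      rw [setLIntegral_indicator measurableSet_Ici, hset, lintegral_const_mul _ (by fun_prop),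
        setLIntegral_Icc_rpow_kernel hβ hw]

theorem measurable_measure_smul_mem {E : Type*} [MeasurableSpace E] [SMul ℝ E]
    [MeasurableSMul₂ ℝ E] (N : Measure E) [SFinite N] {A : Set E} (hA : MeasurableSet A) :
    Measurable fun w : ℝ => N {x | w • x ∈ A} :=
  measurable_measure_prodMk_left (measurable_smul hA)

/-- The double-integral computation from the proof of (iv) ⇒ (i) of Proposition 2. -/
theorem double_integral_computation (d : ℕ) (β : ℝ) (hβ : 0 < β)
    (N : Measure (EuclideanSpace ℝ (Fin d))) [SFinite N]
    (A : Set (EuclideanSpace ℝ (Fin d))) (hA : MeasurableSet A) :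
    ∫⁻ s in Ioc (0:ℝ) 1,
        (∫⁻ t in Ioc (0:ℝ) 1, N {x | (t ^ (1 / β) * s) • x ∈ A}) * ENNReal.ofReal s⁻¹
      = ∫⁻ w in Ioc (0:ℝ) 1, N {x | w • x ∈ A} * ENNReal.ofReal (w⁻¹ - w ^ (β - 1)) :=
  setLIntegral_setLIntegral_comp_rpow_mul (measurable_measure_smul_mem N hA) hβ
end

section
/- Let β > 0, let N be an s-finite Borel measure on ℝ^d, and let A ⊆ ℝ^d be a Borel set such that N^∼(A) := ∫_{(0,1]} N({x : t • x ∈ A}) t⁻¹ dt < ∞. Define N^{(β)}(B) := β ∫_{(0,1]} N({x : s • x ∈ B}) s^{β−1} ds for Borel sets B, and (N^{(β)})^∼(A) := ∫_{(0,1]} N^{(β)}({x : t • x ∈ A}) t⁻¹ dt. Then β · ( N^∼(A) − (N^{(β)})^∼(A) ) = N^{(β)}(A). -/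
open MeasureTheory Set

theorem measurable_measure_smul_preimage {E : Type*} [MeasurableSpace E] [SMul ℝ E]
    [MeasurableSMul₂ ℝ E] (N : Measure E) [SFinite N] {A : Set E} (hA : MeasurableSet A) :
    Measurable fun t : ℝ => N {x | t • x ∈ A} :=
  measurable_measure_prodMk_left (measurable_smul hA)

theorem lintegral_Ioc_comp_mul_left_rpow (F : ℝ → ENNReal) (β : ℝ) {t : ℝ} (ht : 0 < t) :
    ∫⁻ s in Ioc (0 : ℝ) 1, F (t * s) * ENNReal.ofReal (s ^ (β - 1)) =
      ENNReal.ofReal (t ^ (-β)) *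
        ∫⁻ u in Ioc 0 t, F u * ENNReal.ofReal (u ^ (β - 1)) := by
  have himage : (fun s => t * s) '' Ioc (0 : ℝ) 1 = Ioc 0 t := by
    simp [image_mul_left_Ioc ht]
  rw [← himage, lintegral_image_eq_lintegral_abs_deriv_mul measurableSet_Ioc
    (f' := fun _ => t)
    (fun s _ => by simpa using ((hasDerivAt_id s).const_mul t).hasDerivWithinAt)
    (mul_right_injective₀ ht.ne').injOn,
    ← lintegral_const_mul' _ _ ENNReal.ofReal_ne_top]
  refine setLIntegral_congr_fun measurableSet_Ioc fun s hs => ?_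
  have hpow : s ^ (β - 1) = t ^ (-β) * (t * (t * s) ^ (β - 1)) := by
    rw [Real.mul_rpow ht.le hs.1.le, Real.rpow_sub_one ht.ne', Real.rpow_neg ht.le]
    have := (Real.rpow_pos_of_pos ht β).ne'
    field_simp
  have hprod : ENNReal.ofReal (s ^ (β - 1)) = ENNReal.ofReal (t ^ (-β)) *
      (ENNReal.ofReal t * ENNReal.ofReal ((t * s) ^ (β - 1))) := by
    rw [hpow, ENNReal.ofReal_mul (by positivity), ENNReal.ofReal_mul ht.le]
  simp only [hprod, abs_of_pos ht]
  ring

theorem lintegral_Icc_mul_rpow_neg_sub_one {β u : ℝ} (hβ : 0 < β) (hu : u ∈ Ioc (0 : ℝ) 1) :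
    ∫⁻ t in Icc u 1, ENNReal.ofReal (β * t ^ (-β - 1)) = ENNReal.ofReal (u ^ (-β) - 1) := by
  have hzero : (0 : ℝ) ∉ uIcc u 1 := by
    rw [uIcc_of_le hu.2]
    exact fun h => hu.1.not_ge h.1
  have hint : IntervalIntegrable (fun t : ℝ => β * t ^ (-β - 1)) volume u 1 :=
    (intervalIntegral.intervalIntegrable_rpow (Or.inr hzero)).const_mul β
  rw [setLIntegral_congr Ioc_ae_eq_Icc.symm, ← ofReal_integral_eq_lintegral_ofReal
    ((intervalIntegrable_iff_integrableOn_Ioc_of_le hu.2).1 hint),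
    ← intervalIntegral.integral_of_le hu.2, intervalIntegral.integral_const_mul,
    integral_rpow (Or.inr ⟨by linarith, hzero⟩)]
  · congr 1
    rw [sub_add_cancel, Real.one_rpow]
    field_simp
    ring
  · filter_upwards [ae_restrict_mem measurableSet_Ioc] with t ht
    exact mul_nonneg hβ.le (Real.rpow_nonneg (hu.1.trans ht.1).le _)

theorem lintegral_Ioc_lintegral_comp_mul_add {F : ℝ → ENNReal} (hF : Measurable F) {β : ℝ}
    (hβ : 0 < β) :
    (∫⁻ t in Ioc (0 : ℝ) 1, (ENNReal.ofReal β *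
        ∫⁻ s in Ioc (0 : ℝ) 1, F (t * s) * ENNReal.ofReal (s ^ (β - 1))) * ENNReal.ofReal t⁻¹) +
      ∫⁻ s in Ioc (0 : ℝ) 1, F s * ENNReal.ofReal (s ^ (β - 1)) =
    ∫⁻ t in Ioc (0 : ℝ) 1, F t * ENNReal.ofReal t⁻¹ := by
  let K : ℝ → ℝ → ENNReal := fun t u => {p : ℝ × ℝ | p.2 ≤ p.1}.indicator
    (fun p => F p.2 * ENNReal.ofReal (p.2 ^ (β - 1)) *
      ENNReal.ofReal (β * p.1 ^ (-β - 1))) (t, u)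
  have hK : Measurable (Function.uncurry K) := by
    refine Measurable.indicator ?_ (measurableSet_le measurable_snd measurable_fst)
    fun_prop
  have hinner : ∀ t ∈ Ioc (0 : ℝ) 1, (ENNReal.ofReal β *
      ∫⁻ s in Ioc (0 : ℝ) 1, F (t * s) * ENNReal.ofReal (s ^ (β - 1))) * ENNReal.ofReal t⁻¹ =
      ∫⁻ u in Ioc (0 : ℝ) 1, K t u := by
    intro t ht
    have hKt : K t = (Iic t).indicator (fun u => F u * ENNReal.ofReal (u ^ (β - 1)) *
        ENNReal.ofReal (β * t ^ (-β - 1))) := rfl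
    rw [hKt, setLIntegral_indicator measurableSet_Iic, inter_comm, Ioc_inter_Iic,
      min_eq_right ht.2, lintegral_mul_const' _ _ ENNReal.ofReal_ne_top,
      lintegral_Ioc_comp_mul_left_rpow F β ht.1, Real.rpow_sub_one ht.1.ne', div_eq_mul_inv,
      ENNReal.ofReal_mul hβ.le, ENNReal.ofReal_mul (Real.rpow_nonneg ht.1.le _)]
    ring
  have houter : ∀ u ∈ Ioc (0 : ℝ) 1, ∫⁻ t in Ioc (0 : ℝ) 1, K t u =
      F u * ENNReal.ofReal (u ^ (β - 1)) * ENNReal.ofReal (u ^ (-β) - 1) := by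
    intro u hu
    have hKu : (fun t => K t u) = (Ici u).indicator (fun t => F u *
        ENNReal.ofReal (u ^ (β - 1)) * ENNReal.ofReal (β * t ^ (-β - 1))) := rfl
    have hset : Ici u ∩ Ioc 0 1 = Icc u 1 := by
      ext t
      exact ⟨fun h => ⟨h.1, h.2.2⟩, fun h => ⟨h.1, hu.1.trans_le h.1, h.2⟩⟩
    rw [hKu, setLIntegral_indicator measurableSet_Ici, hset,
      lintegral_const_mul _ (by fun_prop), lintegral_Icc_mul_rpow_neg_sub_one hβ hu]
  rw [setLIntegral_congr_fun measurableSet_Ioc hinner,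
    lintegral_lintegral_swap hK.aemeasurable,
    setLIntegral_congr_fun measurableSet_Ioc houter, ← lintegral_add_right _ (by fun_prop)]
  refine setLIntegral_congr_fun measurableSet_Ioc fun u hu => ?_
  have hone : 1 ≤ u ^ (-β) :=
    Real.one_le_rpow_of_pos_of_le_one_of_nonpos hu.1 hu.2 (by linarith)
  have hpow : ENNReal.ofReal (u ^ (β - 1)) * (ENNReal.ofReal (u ^ (-β) - 1) + 1) =
      ENNReal.ofReal u⁻¹ := by
    rw [← ENNReal.ofReal_one, ← ENNReal.ofReal_add (by linarith) zero_le_one, sub_add_cancel,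
      ← ENNReal.ofReal_mul (Real.rpow_nonneg hu.1.le _), ← Real.rpow_add hu.1,
      show β - 1 + -β = -1 by ring, Real.rpow_neg_one]
  simp only [← hpow]
  ring

/-- The key Lévy spectral measure identity (β(N − N^{(β)}))^∼ = N^{(β)} from the
proof of (iv) ⇒ (i) of Proposition 2. -/
theorem key_levy_measure_identity (d : ℕ) (β : ℝ) (hβ : 0 < β)
    (N : Measure (EuclideanSpace ℝ (Fin d))) [SFinite N]
    (A : Set (EuclideanSpace ℝ (Fin d))) (hA : MeasurableSet A)
    (hfin : ∫⁻ t in Ioc (0:ℝ) 1, N {x | t • x ∈ A} * ENNReal.ofReal t⁻¹ < ⊤) :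
    ENNReal.ofReal β *
      ((∫⁻ t in Ioc (0:ℝ) 1, N {x | t • x ∈ A} * ENNReal.ofReal t⁻¹) -
        ∫⁻ t in Ioc (0:ℝ) 1,
          (ENNReal.ofReal β *
            ∫⁻ s in Ioc (0:ℝ) 1,
              N {x | s • x ∈ {z | t • z ∈ A}} * ENNReal.ofReal (s ^ (β - 1))) *
            ENNReal.ofReal t⁻¹)
      = ENNReal.ofReal β *
          ∫⁻ s in Ioc (0:ℝ) 1, N {x | s • x ∈ A} * ENNReal.ofReal (s ^ (β - 1)) := by
  have hidentity := lintegral_Ioc_lintegral_comp_mul_add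
    (measurable_measure_smul_preimage N hA) hβ
  simp only [mul_smul] at hidentity
  simp only [mem_ofPred_eq]
  rw [← hidentity] at hfin ⊢
  rw [ENNReal.add_sub_cancel_left (ENNReal.add_lt_top.1 hfin).1.ne]
end

section
/- Let β > 0 and let N be a Borel measure on ℝ^d with N({x : ‖x‖ > 1}) < ∞. Then β ∫_{(0,1]} s^{β−1} ( ∫_{{w : ‖w‖ > 1/s}} (w/‖w‖) dN(w) ) ds = ∫_{{w : ‖w‖ > 1}} (w/‖w‖) dN(w) − ∫_{{w : ‖w‖ > 1}} (w/‖w‖^{1+β}) dN(w), where the inner integrals are Bochner integrals of ℝ^d-valued functions and the outer integral is a Bochner integral over (0,1]. -/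
open MeasureTheory Set

section

lemma measurableSet_lt_norm {E : Type*} [NormedAddCommGroup E] [MeasurableSpace E] [BorelSpace E]
    (r : ℝ) : MeasurableSet {w : E | r < ‖w‖} :=
  measurableSet_lt measurable_const measurable_norm

lemma integrableOn_Ioc_rpow_sub_one {β : ℝ} (hβ : 0 < β) :
    IntegrableOn (fun s : ℝ => s ^ (β - 1)) (Ioc 0 1) := by
  rw [← intervalIntegrable_iff_integrableOn_Ioc_of_le zero_le_one]
  exact intervalIntegral.intervalIntegrable_rpow' (by linarith)

variable {E : Type*} [NormedAddCommGroup E] [NormedSpace ℝ E]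

lemma norm_inv_norm_smul_le_one (w : E) : ‖‖w‖⁻¹ • w‖ ≤ 1 := by
  rw [norm_smul, norm_inv, norm_norm]
  exact inv_mul_le_one

lemma integral_Ioc_indicator_rpow_smul [CompleteSpace E] {β : ℝ} (hβ : 0 < β) {w : E}
    (hw : 1 < ‖w‖) :
    β • ∫ s in Ioc (0 : ℝ) 1,
        {w : E | 1 / s < ‖w‖}.indicator (fun w => s ^ (β - 1) • ‖w‖⁻¹ • w) w
      = ‖w‖⁻¹ • w - (‖w‖ ^ (1 + β))⁻¹ • w := by
  have h0 : 0 < ‖w‖ := by linarith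
  have hset : ∫ s in Ioc (0 : ℝ) 1,
        {w : E | 1 / s < ‖w‖}.indicator (fun w => s ^ (β - 1) • ‖w‖⁻¹ • w) w
      = ∫ s in Ioc ‖w‖⁻¹ 1, s ^ (β - 1) • ‖w‖⁻¹ • w := by
    rw [← integral_indicator measurableSet_Ioc, ← integral_indicator measurableSet_Ioc]
    congr 1 with s
    by_cases hs : 0 < s
    · have hiff : 1 / s < ‖w‖ ↔ ‖w‖⁻¹ < s := by
        rw [one_div, inv_lt_comm₀ hs h0]
      by_cases h1 : s ≤ 1 <;> by_cases h2 : ‖w‖⁻¹ < s <;>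
        simp only [indicator, mem_Ioc, mem_ofPred_eq, hiff, hs, h1, h2, and_self, and_true,
          and_false, if_true, if_false]
    · have : ¬ ‖w‖⁻¹ < s := fun h => hs ((inv_pos.2 h0).trans h)
      simp [indicator, hs, this]
  rw [hset, integral_smul_const, ← intervalIntegral.integral_of_le (inv_le_one_of_one_le₀ hw.le),
    integral_rpow (Or.inl (by linarith)), smul_smul, smul_smul, ← sub_smul]
  congr 1
  rw [sub_add_cancel, Real.one_rpow, Real.inv_rpow h0.le, Real.rpow_add h0, Real.rpow_one]
  have : ‖w‖ ^ β ≠ 0 := (Real.rpow_pos_of_pos h0 _).ne'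
  field_simp

variable [MeasurableSpace E] [BorelSpace E]

lemma stronglyMeasurable_inv_norm_smul [SecondCountableTopology E] :
    StronglyMeasurable (fun w : E => ‖w‖⁻¹ • w) :=
  (measurable_norm.inv.smul measurable_id).stronglyMeasurable

lemma integrableOn_inv_norm_smul [SecondCountableTopology E] {N : Measure E}
    (hN : N {x | 1 < ‖x‖} < ⊤) :
    IntegrableOn (fun w : E => ‖w‖⁻¹ • w) {w | 1 < ‖w‖} N :=
  Measure.integrableOn_of_bounded hN.ne stronglyMeasurable_inv_norm_smul.aestronglyMeasurable
    (Filter.Eventually.of_forall norm_inv_norm_smul_le_one)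

lemma integrableOn_inv_norm_rpow_smul [SecondCountableTopology E] {β : ℝ} (hβ : 0 < β)
    {N : Measure E} (hN : N {x | 1 < ‖x‖} < ⊤) :
    IntegrableOn (fun w : E => (‖w‖ ^ (1 + β))⁻¹ • w) {w | 1 < ‖w‖} N := by
  refine Measure.integrableOn_of_bounded (M := 1) hN.ne
    ((measurable_norm.pow_const _).inv.smul measurable_id).aestronglyMeasurable ?_
  refine (ae_restrict_iff' (measurableSet_lt_norm 1)).2 (Filter.Eventually.of_forall ?_)
  intro w (hw : 1 < ‖w‖)
  have h0 : 0 < ‖w‖ ^ (1 + β) := Real.rpow_pos_of_pos (by linarith) _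
  rw [norm_smul, norm_inv, Real.norm_of_nonneg h0.le, inv_mul_le_iff₀ h0, mul_one]
  exact Real.self_le_rpow_of_one_le hw.le (by linarith)

lemma integrable_indicator_rpow_smul [SecondCountableTopology E] {β : ℝ} (hβ : 0 < β)
    {N : Measure E} [IsFiniteMeasure N] :
    Integrable (Function.uncurry fun (s : ℝ) (w : E) =>
        {w : E | 1 / s < ‖w‖}.indicator (fun w => s ^ (β - 1) • ‖w‖⁻¹ • w) w)
      ((volume.restrict (Ioc (0 : ℝ) 1)).prod N) := by
  have hint : Integrable (fun p : ℝ × E => p.1 ^ (β - 1) • ‖p.2‖⁻¹ • p.2)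
      ((volume.restrict (Ioc (0 : ℝ) 1)).prod N) :=
    Integrable.smul_prod (integrableOn_Ioc_rpow_sub_one hβ) <|
      Integrable.of_bound stronglyMeasurable_inv_norm_smul.aestronglyMeasurable 1
        (Filter.Eventually.of_forall norm_inv_norm_smul_le_one)
  have hS : MeasurableSet {p : ℝ × E | 1 / p.1 < ‖p.2‖} :=
    measurableSet_lt (by fun_prop) (by fun_prop)
  exact hint.indicator hS

lemma smul_integral_rpow_smul_setIntegral_inv_norm_smul [CompleteSpace E]
    [SecondCountableTopology E] {β : ℝ} (hβ : 0 < β) {N : Measure E}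
    (hN : N {x | 1 < ‖x‖} < ⊤) :
    β • ∫ s in Ioc (0 : ℝ) 1, s ^ (β - 1) • ∫ w in {w : E | 1 / s < ‖w‖}, ‖w‖⁻¹ • w ∂N
      = (∫ w in {w : E | 1 < ‖w‖}, ‖w‖⁻¹ • w ∂N) -
          ∫ w in {w : E | 1 < ‖w‖}, (‖w‖ ^ (1 + β))⁻¹ • w ∂N := by
  have : IsFiniteMeasure (N.restrict {w : E | 1 < ‖w‖}) := ⟨by simpa using hN⟩
  have hinner : ∀ s ∈ Ioc (0 : ℝ) 1,
      s ^ (β - 1) • ∫ w in {w : E | 1 / s < ‖w‖}, ‖w‖⁻¹ • w ∂N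
        = ∫ w in {w : E | 1 < ‖w‖},
            {w : E | 1 / s < ‖w‖}.indicator (fun w => s ^ (β - 1) • ‖w‖⁻¹ • w) w ∂N := by
    intro s hs
    have hsub : {w : E | 1 / s < ‖w‖} ⊆ {w : E | 1 < ‖w‖} := fun w hw =>
      (one_le_one_div hs.1 hs.2).trans_lt hw
    rw [setIntegral_indicator (measurableSet_lt_norm _), inter_eq_right.2 hsub, integral_smul]
  rw [setIntegral_congr_fun measurableSet_Ioc hinner,
    integral_integral_swap (integrable_indicator_rpow_smul hβ), ← integral_smul,
    ← integral_sub (integrableOn_inv_norm_smul hN) (integrableOn_inv_norm_rpow_smul hβ hN)]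
  exact setIntegral_congr_fun (measurableSet_lt_norm 1) fun w hw =>
    integral_Ioc_indicator_rpow_smul hβ hw

end

/-- The shift-vector computation from the proof of (iv) ⇒ (i) of Proposition 2. -/
theorem shift_vector_computation (d : ℕ) (β : ℝ) (hβ : 0 < β)
    (N : Measure (EuclideanSpace ℝ (Fin d)))
    (hN : N {x | 1 < ‖x‖} < ⊤) :
    β • ∫ s in Ioc (0:ℝ) 1,
        s ^ (β - 1) •
          ∫ w in {w : EuclideanSpace ℝ (Fin d) | 1 / s < ‖w‖}, ‖w‖⁻¹ • w ∂N
      = (∫ w in {w : EuclideanSpace ℝ (Fin d) | 1 < ‖w‖}, ‖w‖⁻¹ • w ∂N) -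
          ∫ w in {w : EuclideanSpace ℝ (Fin d) | 1 < ‖w‖}, (‖w‖ ^ (1 + β))⁻¹ • w ∂N :=
  smul_integral_rpow_smul_setIntegral_inv_norm_smul hβ hN
end

section
/- Let N be an s-finite Borel measure on ℝ^d. Then ∫_{(0,1]} N({x : ‖x‖ > 1/t}) t⁻¹ dt = ∫_{{x : ‖x‖ > 1}} log ‖x‖ dN(x), where both sides are Lebesgue integrals with values in [0,∞]. -/
open MeasureTheory Set

/-- The integral of `t⁻¹` over `(r⁻¹, 1]` is `log r` when `1 < r`. -/
theorem lintegral_ofReal_inv_Ioc_inv_one {r : ℝ} (hr : 1 < r) :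
    ∫⁻ t in Ioc r⁻¹ 1, ENNReal.ofReal t⁻¹ = ENNReal.ofReal (Real.log r) := by
  have hr0 : 0 < r⁻¹ := by positivity
  have hr1 : r⁻¹ ≤ 1 := inv_le_one_of_one_le₀ hr.le
  have hint : IntervalIntegrable (fun t : ℝ => t⁻¹) volume r⁻¹ 1 := by
    refine intervalIntegral.intervalIntegrable_inv (fun t ht => ?_) continuousOn_id
    rw [uIcc_of_le hr1] at ht
    exact (hr0.trans_le ht.1).ne'
  rw [← ofReal_integral_eq_lintegral_ofReal hint.1, ← intervalIntegral.integral_of_le hr1,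
    integral_inv_of_pos hr0 one_pos, one_div, inv_inv]
  filter_upwards [ae_restrict_mem measurableSet_Ioc] with t ht
  exact inv_nonneg.2 (hr0.trans ht.1).le

theorem setLIntegral_Ioc_indicator_one_div_lt (r : ℝ) :
    ∫⁻ t in Ioc (0 : ℝ) 1, {t : ℝ | 1 / t < r}.indicator (fun t => ENNReal.ofReal t⁻¹) t
      = (Ioi 1).indicator (fun r => ENNReal.ofReal (Real.log r)) r := by
  rw [setLIntegral_indicator (measurableSet_lt (by fun_prop) measurable_const)]
  by_cases hr : 1 < r
  · have hset : {t : ℝ | 1 / t < r} ∩ Ioc 0 1 = Ioc r⁻¹ 1 := by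
      ext t
      simp only [mem_inter_iff, mem_ofPred_eq, mem_Ioc, one_div]
      have hr0 : 0 < r := one_pos.trans hr
      constructor
      · rintro ⟨h, h0, h1⟩
        exact ⟨inv_lt_of_inv_lt₀ h0 h, h1⟩
      · rintro ⟨h, h1⟩
        exact ⟨inv_lt_of_inv_lt₀ hr0 h, (inv_pos.2 hr0).trans h, h1⟩
    rw [hset, indicator_of_mem (mem_Ioi.2 hr), lintegral_ofReal_inv_Ioc_inv_one hr]
  · have hset : {t : ℝ | 1 / t < r} ∩ Ioc 0 1 = ∅ := by
      refine eq_empty_of_forall_notMem ?_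
      rintro t ⟨h, h0, h1⟩
      exact hr (((one_le_div h0).2 h1).trans_lt h)
    rw [hset, indicator_of_notMem (by simpa using hr)]
    simp

/-- The transformation M^∼ evaluated at the complement of the closed unit ball equals the
logarithmic moment of the Lévy measure. -/
theorem log_moment_identity (d : ℕ)
    (N : Measure (EuclideanSpace ℝ (Fin d))) [SFinite N] :
    ∫⁻ t in Ioc (0:ℝ) 1, N {x | 1 / t < ‖x‖} * ENNReal.ofReal t⁻¹
      = ∫⁻ x in {x : EuclideanSpace ℝ (Fin d) | 1 < ‖x‖},
          ENNReal.ofReal (Real.log ‖x‖) ∂N := by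
  let f : ℝ → EuclideanSpace ℝ (Fin d) → ENNReal := fun t x =>
    {t : ℝ | 1 / t < ‖x‖}.indicator (fun t => ENNReal.ofReal t⁻¹) t
  have hf : Measurable (Function.uncurry f) :=
    Measurable.indicator (s := {p : ℝ × EuclideanSpace ℝ (Fin d) | 1 / p.1 < ‖p.2‖})
      (f := fun p => ENNReal.ofReal p.1⁻¹) (by fun_prop)
      (measurableSet_lt (by fun_prop) (by fun_prop))
  calc ∫⁻ t in Ioc (0:ℝ) 1, N {x | 1 / t < ‖x‖} * ENNReal.ofReal t⁻¹
      = ∫⁻ t in Ioc (0:ℝ) 1, ∫⁻ x, f t x ∂N := by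
        refine lintegral_congr fun t => ?_
        rw [mul_comm]
        exact (lintegral_indicator_const (measurableSet_lt measurable_const measurable_norm)
          (ENNReal.ofReal t⁻¹)).symm
    _ = ∫⁻ x, (∫⁻ t in Ioc (0:ℝ) 1, f t x) ∂N := lintegral_lintegral_swap hf.aemeasurable
    _ = ∫⁻ x, {x : EuclideanSpace ℝ (Fin d) | 1 < ‖x‖}.indicator
          (fun x => ENNReal.ofReal (Real.log ‖x‖)) x ∂N :=
        lintegral_congr fun x => setLIntegral_Ioc_indicator_one_div_lt ‖x‖
    _ = _ := lintegral_indicator (measurableSet_lt measurable_const measurable_norm) _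
end

section
/- Let β > 0, let M be an s-finite Borel measure on ℝ^d, and let A ⊆ ℝ^d be a Borel set. Define N(B) := β⁻¹ M(B) + ∫_{(0,1]} M({x : t • x ∈ B}) t⁻¹ dt for Borel sets B. Then β ∫_{(0,1]} N({x : s • x ∈ A}) s^{β−1} ds = ∫_{(0,1]} M({x : t • x ∈ A}) t⁻¹ dt, where all integrals are Lebesgue integrals with values in [0,∞]. -/
open MeasureTheory Set
open scoped ENNReal

lemma measurable_measure_dilate {E : Type*} [NormedAddCommGroup E] [NormedSpace ℝ E]
    [MeasurableSpace E] [BorelSpace E] [SecondCountableTopology E]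
    (M : Measure E) [SFinite M] {A : Set E} (hA : MeasurableSet A) :
    Measurable fun t : ℝ => M {x | t • x ∈ A} := by
  have h : MeasurableSet {p : ℝ × E | p.1 • p.2 ∈ A} :=
    (measurable_fst.smul measurable_snd) hA
  exact measurable_measure_prodMk_left h

lemma setLIntegral_Icc_rpow_sub_one {β u : ℝ} (hβ : 0 < β) (hu : 0 < u) (hu1 : u ≤ 1) :
    ∫⁻ s in Icc u 1, ENNReal.ofReal (s ^ (β - 1)) = ENNReal.ofReal ((1 - u ^ β) / β) := by
  rw [← setLIntegral_congr Ioc_ae_eq_Icc, ← ofReal_integral_eq_lintegral_ofReal,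
    ← intervalIntegral.integral_of_le hu1, integral_rpow (Or.inl (by linarith))]
  · simp
  · exact (intervalIntegrable_iff_integrableOn_Ioc_of_le hu1).1
      (intervalIntegral.intervalIntegrable_rpow' (by linarith))
  · filter_upwards [ae_restrict_mem measurableSet_Ioc] with s hs
    exact Real.rpow_nonneg (hu.trans hs.1).le _

lemma setLIntegral_dilate_inv (g : ℝ → ℝ≥0∞) {s : ℝ} (hs : 0 < s) :
    ∫⁻ t in Ioc (0:ℝ) 1, g (s * t) * ENNReal.ofReal t⁻¹
      = ∫⁻ u in Ioc 0 s, g u * ENNReal.ofReal u⁻¹ := by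
  have himage : (fun t => s * t) '' Ioc (0:ℝ) 1 = Ioc 0 s := by
    simp [image_mul_left_Ioc hs]
  rw [← himage, lintegral_image_eq_lintegral_abs_deriv_mul measurableSet_Ioc
    (f' := fun _ => s) (fun x _ => by simpa using ((hasDerivAt_id x).const_mul s).hasDerivWithinAt)
    (mul_right_injective₀ hs.ne').injOn]
  refine setLIntegral_congr_fun measurableSet_Ioc fun t ht => ?_
  have h : ENNReal.ofReal |s| * ENNReal.ofReal (s * t)⁻¹ = ENNReal.ofReal t⁻¹ := by
    rw [← ENNReal.ofReal_mul (abs_nonneg s), abs_of_pos hs]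
    congr 1
    field_simp
  simp only [← h]
  ring

lemma setLIntegral_mul_swap {h w : ℝ → ℝ≥0∞} (hh : Measurable h) (hw : Measurable w) :
    ∫⁻ s in Ioc (0:ℝ) 1, (∫⁻ u in Ioc 0 s, h u) * w s
      = ∫⁻ u in Ioc (0:ℝ) 1, h u * ∫⁻ s in Icc u 1, w s := by
  have hmeas : MeasurableSet {p : ℝ × ℝ | p.2 ≤ p.1} :=
    measurableSet_le measurable_snd measurable_fst
  let F : ℝ × ℝ → ℝ≥0∞ := {p : ℝ × ℝ | p.2 ≤ p.1}.indicator fun p => h p.2 * w p.1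
  have hF : Measurable F :=
    ((hh.comp measurable_snd).mul (hw.comp measurable_fst)).indicator hmeas
  calc _ = ∫⁻ s in Ioc (0:ℝ) 1, ∫⁻ u in Ioc (0:ℝ) 1, F (s, u) := by
        refine setLIntegral_congr_fun measurableSet_Ioc fun s hs => ?_
        have hset : Iic s ∩ Ioc 0 1 = Ioc 0 s := by
          ext u; simp only [mem_inter_iff, mem_Iic, mem_Ioc] at *; grind
        have hFs : (fun u => F (s, u)) = (Iic s).indicator fun u => h u * w s := rfl
        simp only [hFs]
        rw [lintegral_indicator measurableSet_Iic, Measure.restrict_restrict measurableSet_Iic,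
          hset, lintegral_mul_const _ hh]
    _ = ∫⁻ u in Ioc (0:ℝ) 1, ∫⁻ s in Ioc (0:ℝ) 1, F (s, u) :=
        lintegral_lintegral_swap hF.aemeasurable
    _ = _ := by
        refine setLIntegral_congr_fun measurableSet_Ioc fun u hu => ?_
        have hset : Ici u ∩ Ioc 0 1 = Icc u 1 := by
          ext s; simp only [mem_inter_iff, mem_Ici, mem_Ioc, mem_Icc] at *; grind
        have hFu : (fun s => F (s, u)) = (Ici u).indicator fun s => h u * w s := rfl
        simp only [hFu]
        rw [lintegral_indicator measurableSet_Ici, Measure.restrict_restrict measurableSet_Ici,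
          hset, lintegral_const_mul _ hw]

lemma lintegral_rpow_add_dilate_inv {β : ℝ} (hβ : 0 < β) {g : ℝ → ℝ≥0∞} (hg : Measurable g) :
    ENNReal.ofReal β * ∫⁻ s in Ioc (0:ℝ) 1,
        (ENNReal.ofReal β⁻¹ * g s + ∫⁻ t in Ioc (0:ℝ) 1, g (s * t) * ENNReal.ofReal t⁻¹)
          * ENNReal.ofReal (s ^ (β - 1))
      = ∫⁻ t in Ioc (0:ℝ) 1, g t * ENNReal.ofReal t⁻¹ := by
  have hw : Measurable fun s : ℝ => ENNReal.ofReal (s ^ (β - 1)) := by fun_prop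
  have hinv : Measurable fun s : ℝ => ENNReal.ofReal s⁻¹ := by fun_prop
  have hh : Measurable fun u : ℝ => g u * ENNReal.ofReal u⁻¹ := hg.mul hinv
  have hgw : Measurable fun s : ℝ => ENNReal.ofReal β⁻¹ * g s * ENNReal.ofReal (s ^ (β - 1)) :=
    (hg.const_mul _).mul hw
  have hsplit : ∫⁻ s in Ioc (0:ℝ) 1,
        (ENNReal.ofReal β⁻¹ * g s + ∫⁻ t in Ioc (0:ℝ) 1, g (s * t) * ENNReal.ofReal t⁻¹)
          * ENNReal.ofReal (s ^ (β - 1))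
      = (∫⁻ s in Ioc (0:ℝ) 1, ENNReal.ofReal β⁻¹ * g s * ENNReal.ofReal (s ^ (β - 1)))
        + ∫⁻ s in Ioc (0:ℝ) 1,
          (∫⁻ u in Ioc 0 s, g u * ENNReal.ofReal u⁻¹) * ENNReal.ofReal (s ^ (β - 1)) := by
    rw [← lintegral_add_left hgw]
    refine setLIntegral_congr_fun measurableSet_Ioc fun s hs => ?_
    simp only [setLIntegral_dilate_inv g hs.1, add_mul]
  rw [hsplit, setLIntegral_mul_swap hh hw,
    ← lintegral_add_left hgw,
    ← lintegral_const_mul' _ _ ENNReal.ofReal_ne_top]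
  refine setLIntegral_congr_fun measurableSet_Ioc fun u hu => ?_
  have hpow : u ^ β ≤ 1 := Real.rpow_le_one hu.1.le hu.2 hβ.le
  have key : ENNReal.ofReal β * (ENNReal.ofReal β⁻¹ * ENNReal.ofReal (u ^ (β - 1))
      + ENNReal.ofReal u⁻¹ * ENNReal.ofReal ((1 - u ^ β) / β)) = ENNReal.ofReal u⁻¹ := by
    have hu0 := hu.1
    have h1 : 0 ≤ (1 - u ^ β) / β := div_nonneg (by linarith) hβ.le
    rw [← ENNReal.ofReal_mul (by positivity), ← ENNReal.ofReal_mul (by positivity),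
      ← ENNReal.ofReal_add (by positivity) (by positivity), ← ENNReal.ofReal_mul hβ.le,
      Real.rpow_sub_one hu0.ne']
    congr 1
    field_simp
    ring
  simp only [setLIntegral_Icc_rpow_sub_one hβ hu.1 hu.2]
  refine Eq.trans ?_ (congrArg (g u * ·) key)
  ring

/-- The Lévy-spectral-measure consistency behind Corollary 2. -/
theorem corollary2_levy_measure_consistency (d : ℕ) (β : ℝ) (hβ : 0 < β)
    (M : Measure (EuclideanSpace ℝ (Fin d))) [SFinite M]
    (A : Set (EuclideanSpace ℝ (Fin d))) (hA : MeasurableSet A)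
    (N : Set (EuclideanSpace ℝ (Fin d)) → ℝ≥0∞)
    (hN : ∀ B : Set (EuclideanSpace ℝ (Fin d)), MeasurableSet B →
      N B = ENNReal.ofReal β⁻¹ * M B +
        ∫⁻ t in Ioc (0:ℝ) 1, M {x | t • x ∈ B} * ENNReal.ofReal t⁻¹) :
    ENNReal.ofReal β *
        ∫⁻ s in Ioc (0:ℝ) 1, N {x | s • x ∈ A} * ENNReal.ofReal (s ^ (β - 1))
      = ∫⁻ t in Ioc (0:ℝ) 1, M {x | t • x ∈ A} * ENNReal.ofReal t⁻¹ := by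
  have hg := measurable_measure_dilate M hA
  rw [← lintegral_rpow_add_dilate_inv hβ hg]
  congr 1
  refine setLIntegral_congr_fun measurableSet_Ioc fun s _ => ?_
  have hB : MeasurableSet {x | s • x ∈ A} := (measurable_const_smul s) hA
  simp only [hN _ hB, mem_ofPred_eq, smul_smul]
end

section
/- Let β > 0 and let Φ : ℝ^d → ℂ be a continuous function such that for every y ∈ ℝ^d the function w ↦ Φ(w • y)/w is Lebesgue integrable on (0,1]. Then for every y ∈ ℝ^d, β ∫_{(0,1]} ( Φ(w • y) − β ∫_{(0,1]} Φ((t w) • y) t^{β−1} dt ) w⁻¹ dw = β ∫_{(0,1]} Φ(t • y) t^{β−1} dt. -/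
open MeasureTheory Set

/-- Rescaling a Mellin-type average over `(0, 1]` to an integral over `(0, w]`. -/
lemma integral_comp_mul_mul_rpow (f : ℝ → ℂ) (β : ℝ) {w : ℝ} (hw : 0 < w) :
    ∫ t in Ioc (0:ℝ) 1, f (t * w) * ((t ^ (β - 1) : ℝ) : ℂ)
      = ((w ^ (-β) : ℝ) : ℂ) * ∫ s in Ioc (0:ℝ) w, f s * ((s ^ (β - 1) : ℝ) : ℂ) := by
  have h := intervalIntegral.integral_comp_mul_right (a := 0) (b := 1)
    (fun s : ℝ => f s * (((s / w) ^ (β - 1) : ℝ) : ℂ)) hw.ne'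
  simp only [mul_div_cancel_right₀ _ hw.ne', zero_mul, one_mul] at h
  rw [intervalIntegral.integral_of_le zero_le_one, intervalIntegral.integral_of_le hw.le] at h
  rw [h, ← integral_smul, ← integral_const_mul]
  refine setIntegral_congr_fun measurableSet_Ioc fun s hs => ?_
  have h1 : w⁻¹ * (s / w) ^ (β - 1) = w ^ (-β) * s ^ (β - 1) := by
    rw [Real.div_rpow hs.1.le hw.le, Real.rpow_sub_one hw.ne', Real.rpow_neg hw.le]
    field_simp
  simp only [Complex.real_smul]
  rw [mul_left_comm, ← Complex.ofReal_mul, h1]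
  push_cast
  ring

/-- The integral of `w ^ (-β - 1)` over `(s, 1]`, written over `(0, 1]` with a cutoff. -/
lemma setIntegral_indicator_rpow {β : ℝ} (hβ : 0 < β) {s : ℝ} (hs : s ∈ Ioc (0:ℝ) 1) :
    ∫ w in Ioc (0:ℝ) 1, (Ioi s).indicator (fun w => w ^ (-β - 1)) w = (s ^ (-β) - 1) / β := by
  rw [setIntegral_indicator measurableSet_Ioi]
  have : Ioc (0:ℝ) 1 ∩ Ioi s = Ioc s 1 := by
    ext x; simp only [mem_inter_iff, mem_Ioc, mem_Ioi]
    exact ⟨fun h => ⟨h.2, h.1.2⟩, fun h => ⟨⟨hs.1.trans h.1, h.2⟩, h.1⟩⟩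
  rw [this, ← intervalIntegral.integral_of_le hs.2, integral_rpow]
  · rw [sub_add_cancel, Real.one_rpow]
    field_simp
    ring
  · refine Or.inr ⟨by linarith, ?_⟩
    rw [uIcc_of_le hs.2]
    exact fun h => absurd h.1 (not_le.2 hs.1)

lemma integrableOn_indicator_rpow (β : ℝ) {s : ℝ} (hs : s ∈ Ioc (0:ℝ) 1) :
    IntegrableOn ((Ioi s).indicator (fun w => w ^ (-β - 1))) (Ioc (0:ℝ) 1) := by
  rw [IntegrableOn, integrable_indicator_iff measurableSet_Ioi, IntegrableOn,
    Measure.restrict_restrict measurableSet_Ioi]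
  have h : IntegrableOn (fun w : ℝ => w ^ (-β - 1)) (Icc s 1) := by
    refine ContinuousOn.integrableOn_Icc fun x hx => ?_
    exact (Real.continuousAt_rpow_const x _ (Or.inl (hs.1.trans_le hx.1).ne')).continuousWithinAt
  exact h.mono_set fun x hx => ⟨le_of_lt hx.1, hx.2.2⟩

lemma integrableOn_mul_rpow {β : ℝ} (hβ : 0 < β) {f : ℝ → ℂ} (hf : Measurable f)
    (hint : IntegrableOn (fun w : ℝ => f w / (w : ℂ)) (Ioc 0 1)) :
    IntegrableOn (fun s : ℝ => f s * ((s ^ (β - 1) : ℝ) : ℂ)) (Ioc 0 1) := by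
  refine Integrable.mono hint (by fun_prop) ?_
  filter_upwards [ae_restrict_mem measurableSet_Ioc] with s hs
  rw [norm_mul, norm_div, Complex.norm_real, Complex.norm_real, Real.norm_of_nonneg hs.1.le,
    Real.norm_of_nonneg (Real.rpow_nonneg hs.1.le _), Real.rpow_sub_one hs.1.ne', mul_div_assoc']
  have := Real.rpow_le_one hs.1.le hs.2 hβ.le
  have := hs.1
  gcongr
  exact mul_le_of_le_one_right (norm_nonneg _) ‹_›

/-- The kernel `w ^ (-β - 1) s ^ (β - 1) f s` on `s < w` is integrable on the unit square. -/
lemma integrable_indicator_rpow_mul {β : ℝ} (hβ : 0 < β) {f : ℝ → ℂ} (hf : Measurable f)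
    (hint : IntegrableOn (fun w : ℝ => f w / (w : ℂ)) (Ioc 0 1)) :
    Integrable (fun p : ℝ × ℝ => (((Ioi p.2).indicator (fun w => w ^ (-β - 1)) p.1 : ℝ) : ℂ) *
        (f p.2 * ((p.2 ^ (β - 1) : ℝ) : ℂ)))
      ((volume.restrict (Ioc (0:ℝ) 1)).prod (volume.restrict (Ioc (0:ℝ) 1))) := by
  have hm : Measurable (fun p : ℝ × ℝ => (Ioi p.2).indicator (fun w => w ^ (-β - 1)) p.1) := by
    have : (fun p : ℝ × ℝ => (Ioi p.2).indicator (fun w => w ^ (-β - 1)) p.1)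
        = {p : ℝ × ℝ | p.2 < p.1}.indicator (fun p => p.1 ^ (-β - 1)) := by
      ext p; simp [indicator]
    rw [this]
    exact Measurable.indicator (by fun_prop) (measurableSet_lt measurable_snd measurable_fst)
  rw [integrable_prod_iff' (by fun_prop)]
  constructor
  · filter_upwards [ae_restrict_mem measurableSet_Ioc] with s hs
    exact (integrableOn_indicator_rpow β hs).ofReal.mul_const _
  · have hb := (hint.norm.sub (integrableOn_mul_rpow hβ hf hint).norm).div_const β
    refine hb.congr ?_
    filter_upwards [ae_restrict_mem measurableSet_Ioc] with s hs
    have h1 : ∀ w ∈ Ioc (0:ℝ) 1, ‖(((Ioi s).indicator (fun w => w ^ (-β - 1)) w : ℝ) : ℂ) *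
        (f s * ((s ^ (β - 1) : ℝ) : ℂ))‖ =
        (Ioi s).indicator (fun w => w ^ (-β - 1)) w * ‖f s * ((s ^ (β - 1) : ℝ) : ℂ)‖ := by
      intro w hw
      rw [norm_mul, Complex.norm_real, Real.norm_of_nonneg]
      exact indicator_apply_nonneg fun _ => Real.rpow_nonneg hw.1.le _
    rw [setIntegral_congr_fun measurableSet_Ioc h1, integral_mul_const,
      setIntegral_indicator_rpow hβ hs]
    simp only [Pi.sub_apply, norm_mul, norm_div, Complex.norm_real,
      Real.norm_of_nonneg hs.1.le, Real.norm_of_nonneg (Real.rpow_nonneg hs.1.le _)]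
    rw [Real.rpow_sub_one hs.1.ne', Real.rpow_neg hs.1.le]
    have := Real.rpow_pos_of_pos hs.1 β
    have := hs.1
    field_simp

lemma integral_sub_mul_inv_eq {β : ℝ} (hβ : 0 < β) {f : ℝ → ℂ} (hf : Measurable f)
    (hint : IntegrableOn (fun w : ℝ => f w / (w : ℂ)) (Ioc 0 1)) :
    ∫ w in Ioc (0:ℝ) 1,
        (f w - (β : ℂ) * ∫ t in Ioc (0:ℝ) 1, f (t * w) * ((t ^ (β - 1) : ℝ) : ℂ)) * (w : ℂ)⁻¹
      = ∫ t in Ioc (0:ℝ) 1, f t * ((t ^ (β - 1) : ℝ) : ℂ) := by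
  have hF := integrable_indicator_rpow_mul hβ hf hint
  have hβ' : (β : ℂ) ≠ 0 := by exact_mod_cast hβ.ne'
  have hinner : ∀ w ∈ Ioc (0:ℝ) 1,
      (f w - (β : ℂ) * ∫ t in Ioc (0:ℝ) 1, f (t * w) * ((t ^ (β - 1) : ℝ) : ℂ)) * (w : ℂ)⁻¹
      = f w / (w : ℂ) - (β : ℂ) * ∫ s in Ioc (0:ℝ) 1,
        (((Ioi s).indicator (fun w => w ^ (-β - 1)) w : ℝ) : ℂ) *
          (f s * ((s ^ (β - 1) : ℝ) : ℂ)) := by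
    intro w hw
    have h1 : (fun s : ℝ => (((Ioi s).indicator (fun w => w ^ (-β - 1)) w : ℝ) : ℂ) *
          (f s * ((s ^ (β - 1) : ℝ) : ℂ)))
        = (Iio w).indicator
          (fun s => ((w ^ (-β - 1) : ℝ) : ℂ) * (f s * ((s ^ (β - 1) : ℝ) : ℂ))) := by
      ext s
      by_cases h : s < w <;> simp [indicator, h]
    have h2 : Ioc (0:ℝ) 1 ∩ Iio w = Ioo 0 w := by
      ext x; simp only [mem_inter_iff, mem_Ioc, mem_Iio, mem_Ioo]
      exact ⟨fun h => ⟨h.1.1, h.2⟩, fun h => ⟨⟨h.1, h.2.le.trans hw.2⟩, h.2⟩⟩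
    rw [h1, setIntegral_indicator measurableSet_Iio, h2, ← integral_Ioc_eq_integral_Ioo,
      integral_const_mul, integral_comp_mul_mul_rpow f β hw.1, Real.rpow_sub_one hw.1.ne']
    push_cast
    ring
  have hswap : ∫ w in Ioc (0:ℝ) 1, ∫ s in Ioc (0:ℝ) 1,
        (((Ioi s).indicator (fun w => w ^ (-β - 1)) w : ℝ) : ℂ) *
          (f s * ((s ^ (β - 1) : ℝ) : ℂ))
      = ∫ s in Ioc (0:ℝ) 1, (f s / (s : ℂ) - f s * ((s ^ (β - 1) : ℝ) : ℂ)) / β := by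
    rw [integral_integral_swap hF]
    refine setIntegral_congr_fun measurableSet_Ioc fun s hs => ?_
    rw [integral_mul_const, integral_complex_ofReal, setIntegral_indicator_rpow hβ hs,
      Real.rpow_sub_one hs.1.ne', Real.rpow_neg hs.1.le]
    have h3 : ((s ^ β : ℝ) : ℂ) ≠ 0 := by exact_mod_cast (Real.rpow_pos_of_pos hs.1 β).ne'
    have h4 : (s : ℂ) ≠ 0 := by exact_mod_cast hs.1.ne'
    push_cast
    field_simp
  rw [setIntegral_congr_fun measurableSet_Ioc hinner,
    integral_sub hint (hF.integral_prod_left.const_mul _), integral_const_mul, hswap,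
    integral_div, integral_sub hint (integrableOn_mul_rpow hβ hf hint)]
  field_simp
  ring

/-- The identity underlying (i)∧(ii) ⇒ (iii) of Proposition 2. -/
theorem prop2_iii_identity (d : ℕ) (β : ℝ) (hβ : 0 < β)
    (Φ : EuclideanSpace ℝ (Fin d) → ℂ) (hΦ : Continuous Φ)
    (hint : ∀ y : EuclideanSpace ℝ (Fin d),
      IntegrableOn (fun w : ℝ => Φ (w • y) / (w : ℂ)) (Ioc 0 1)) :
    ∀ y : EuclideanSpace ℝ (Fin d),
      (β : ℂ) * ∫ w in Ioc (0:ℝ) 1,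
          (Φ (w • y) -
            (β : ℂ) * ∫ t in Ioc (0:ℝ) 1, Φ ((t * w) • y) * ((t ^ (β - 1) : ℝ) : ℂ)) *
          (w : ℂ)⁻¹
        = (β : ℂ) * ∫ t in Ioc (0:ℝ) 1, Φ (t • y) * ((t ^ (β - 1) : ℝ) : ℂ) := by
  intro y
  have hf : Continuous fun w : ℝ => Φ (w • y) := by fun_prop
  rw [integral_sub_mul_inv_eq hβ hf.measurable (hint y)]
end
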